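/- arXiv:2410.22873 — 2 statements merged into one kernel-verified Lean document; each statement's English description precedes it below -/
import Mathlib

section
/- Let Ω' be an open set compactly contained in the bounded open set Ω, and let E, F ⊆ ℝⁿ be measurable sets with F \ Ω' = E \ Ω' (up to a null set) and with ∬_{Ω×Ω} |χ_E(x)−χ_E(y)|²/|x−y|^{n+2s} dx dy < ∞ and ∬_{Ω×Ω} |χ_F(x)−χ_F(y)|²/|x−y|^{n+2s} dx dy < ∞. Then Per_s(E,Ω') − Per_s(F,Ω') ≤ (1/8)( H(E,Ω) − H(F,Ω) ) + 6 ∬_{Ω'×(ℝⁿ\Ω)} |χ_E(x) − χ_F(x)| / |x−y|^{n+2s} dx dy. -/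
open MeasureTheory Filter Set Metric
open scoped ENNReal NNReal Topology RealInnerProductSpace symmDiff

noncomputable section

/-- The indicator function `χ_E`. -/
def chi (n : ℕ) (E : Set (EuclideanSpace ℝ (Fin n))) (x : EuclideanSpace ℝ (Fin n)) : ℝ :=
  E.indicator (fun _ => (1 : ℝ)) x

/-- The function `χ_E - χ_{E^c}`. -/
def pm (n : ℕ) (E : Set (EuclideanSpace ℝ (Fin n))) (x : EuclideanSpace ℝ (Fin n)) : ℝ :=
  E.indicator (fun _ => (1 : ℝ)) x - Eᶜ.indicator (fun _ => (1 : ℝ)) x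

/-- The Gagliardo-type double integral over a set `A ⊆ ℝⁿ × ℝⁿ`. -/
def Jset (n : ℕ) (s : ℝ) (A : Set (EuclideanSpace ℝ (Fin n) × EuclideanSpace ℝ (Fin n)))
    (u : EuclideanSpace ℝ (Fin n) → ℝ) : ℝ≥0∞ :=
  ∫⁻ z in A, ENNReal.ofReal (|u z.1 - u z.2| ^ 2 / ‖z.1 - z.2‖ ^ ((n : ℝ) + 2 * s))

/-- The functional `H(E,Ω)` from the paper. -/
def Hfun (n : ℕ) (s : ℝ) (Ω : Set (EuclideanSpace ℝ (Fin n)))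
    (g : EuclideanSpace ℝ (Fin n) → ℝ) (E : Set (EuclideanSpace ℝ (Fin n))) : ℝ≥0∞ :=
  (∫⁻ z : EuclideanSpace ℝ (Fin n) × EuclideanSpace ℝ (Fin n) in Ω ×ˢ Ω,
      ENNReal.ofReal (|pm n E z.1 - pm n E z.2| ^ 2 / ‖z.1 - z.2‖ ^ ((n : ℝ) + 2 * s))) +
  2 * ∫⁻ z : EuclideanSpace ℝ (Fin n) × EuclideanSpace ℝ (Fin n) in Ω ×ˢ Ωᶜ,
      ENNReal.ofReal (|pm n E z.1 - g z.2| ^ 2 / ‖z.1 - z.2‖ ^ ((n : ℝ) + 2 * s))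

/-- The fractional `s`-perimeter of `E` in the open set `O`. -/
def fracPer (n : ℕ) (s : ℝ) (E O : Set (EuclideanSpace ℝ (Fin n))) : ℝ≥0∞ :=
  (∫⁻ z : EuclideanSpace ℝ (Fin n) × EuclideanSpace ℝ (Fin n) in (E ∩ O) ×ˢ Eᶜ,
      ENNReal.ofReal (‖z.1 - z.2‖ ^ (-(n : ℝ) - 2 * s))) +
  ∫⁻ z : EuclideanSpace ℝ (Fin n) × EuclideanSpace ℝ (Fin n) in (E \ O) ×ˢ (Eᶜ ∩ O),
      ENNReal.ofReal (‖z.1 - z.2‖ ^ (-(n : ℝ) - 2 * s))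

/-- The singular kernel `|x - y|^{-n-2s}`. -/
def rieszKernel (n : ℕ) (s : ℝ) (z : EuclideanSpace ℝ (Fin n) × EuclideanSpace ℝ (Fin n)) : ℝ :=
  ‖z.1 - z.2‖ ^ (-(n : ℝ) - 2 * s)

/-- The interaction measure on `ℝⁿ × ℝⁿ` with density `|x - y|^{-n-2s}`. -/
def interaction (n : ℕ) (s : ℝ) :
    Measure (EuclideanSpace ℝ (Fin n) × EuclideanSpace ℝ (Fin n)) :=
  volume.withDensity fun z => ENNReal.ofReal (rieszKernel n s z)

section

variable {n : ℕ} {s : ℝ} {A B C E F O Ω : Set (EuclideanSpace ℝ (Fin n))}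

lemma rieszKernel_nonneg (z : EuclideanSpace ℝ (Fin n) × EuclideanSpace ℝ (Fin n)) :
    0 ≤ rieszKernel n s z :=
  Real.rpow_nonneg (norm_nonneg _) _

@[fun_prop]
lemma measurable_rieszKernel : Measurable (rieszKernel n s) := by
  unfold rieszKernel
  fun_prop

lemma div_eq_mul_rieszKernel (a : ℝ)
    (z : EuclideanSpace ℝ (Fin n) × EuclideanSpace ℝ (Fin n)) :
    a / ‖z.1 - z.2‖ ^ ((n : ℝ) + 2 * s) = a * rieszKernel n s z := by
  rw [rieszKernel, div_eq_mul_inv, ← Real.rpow_neg (norm_nonneg _)]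
  ring_nf

@[fun_prop]
lemma measurable_chi (hE : MeasurableSet E) : Measurable (chi n E) :=
  measurable_const.indicator hE

lemma pm_eq (x : EuclideanSpace ℝ (Fin n)) : pm n E x = 2 * chi n E x - 1 := by
  by_cases h : x ∈ E
  · simp [pm, chi, h]; norm_num
  · simp [pm, chi, h]

lemma chi_eq_zero_or_one (x : EuclideanSpace ℝ (Fin n)) : chi n E x = 0 ∨ chi n E x = 1 := by
  by_cases h : x ∈ E <;> simp [chi, h]

lemma setLIntegral_rieszKernel (hA : MeasurableSet A) (hB : MeasurableSet B) :
    ∫⁻ z in A ×ˢ B, ENNReal.ofReal (rieszKernel n s z) = interaction n s (A ×ˢ B) :=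
  (withDensity_apply _ (hA.prod hB)).symm

lemma interaction_comm (hA : MeasurableSet A) (hB : MeasurableSet B) :
    interaction n s (A ×ˢ B) = interaction n s (B ×ˢ A) := by
  rw [← setLIntegral_rieszKernel hA hB, ← setLIntegral_rieszKernel hB hA]
  have h := (Measure.measurePreserving_swap
    (μ := (volume : Measure (EuclideanSpace ℝ (Fin n))))
    (ν := (volume : Measure (EuclideanSpace ℝ (Fin n))))).setLIntegral_comp_preimage
      (hA.prod hB) (f := fun z => ENNReal.ofReal (rieszKernel n s z)) (by fun_prop)
  rw [Set.preimage_swap_prod] at h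
  rw [Measure.volume_eq_prod, ← h]
  simp only [rieszKernel, Prod.fst_swap, Prod.snd_swap, norm_sub_rev]

lemma interaction_union_left (hB : MeasurableSet B) (hC : MeasurableSet C) (h : Disjoint A B) :
    interaction n s ((A ∪ B) ×ˢ C) = interaction n s (A ×ˢ C) + interaction n s (B ×ˢ C) := by
  rw [Set.union_prod, measure_union (Set.disjoint_prod.2 (Or.inl h)) (hB.prod hC)]

lemma interaction_union_right (hA : MeasurableSet A) (hC : MeasurableSet C) (h : Disjoint B C) :
    interaction n s (A ×ˢ (B ∪ C)) = interaction n s (A ×ˢ B) + interaction n s (A ×ˢ C) := by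
  rw [Set.prod_union, measure_union (Set.disjoint_prod.2 (Or.inr h)) (hA.prod hC)]

lemma setLIntegral_abs_chi_sub (hA : MeasurableSet A) (hB : MeasurableSet B)
    (hE : MeasurableSet E) :
    ∫⁻ z in A ×ˢ B, ENNReal.ofReal (|chi n E z.1 - chi n E z.2| * rieszKernel n s z) =
      interaction n s ((A ∩ E) ×ˢ (B \ E)) + interaction n s ((A \ E) ×ˢ (B ∩ E)) := by
  rw [← setLIntegral_rieszKernel (hA.inter hE) (hB.diff hE),
    ← setLIntegral_rieszKernel (hA.diff hE) (hB.inter hE),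
    ← lintegral_indicator (hA.prod hB), ← lintegral_indicator ((hA.inter hE).prod (hB.diff hE)),
    ← lintegral_indicator ((hA.diff hE).prod (hB.inter hE)), ← lintegral_add_left
      ((by fun_prop : Measurable fun z => ENNReal.ofReal (rieszKernel n s z)).indicator
        ((hA.inter hE).prod (hB.diff hE)))]
  refine lintegral_congr fun z => ?_
  by_cases h1 : z.1 ∈ A <;> by_cases h2 : z.2 ∈ B <;> by_cases h3 : z.1 ∈ E <;>
    by_cases h4 : z.2 ∈ E <;> simp [chi, h1, h2, h3, h4]

lemma fracPer_eq (hE : MeasurableSet E) (hO : MeasurableSet O) :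
    fracPer n s E O = interaction n s ((E ∩ O) ×ˢ Eᶜ) +
      interaction n s ((E \ O) ×ˢ (Eᶜ ∩ O)) := by
  rw [← setLIntegral_rieszKernel (hE.inter hO) hE.compl,
    ← setLIntegral_rieszKernel (hE.diff hO) (hE.compl.inter hO)]
  rfl

lemma Hfun_eq (g : EuclideanSpace ℝ (Fin n) → ℝ) (hE : MeasurableSet E) (hΩ : MeasurableSet Ω) :
    Hfun n s Ω g E = 8 * interaction n s ((Ω ∩ E) ×ˢ (Ω \ E)) +
      2 * ∫⁻ z in Ω ×ˢ Ωᶜ, ENNReal.ofReal (|pm n E z.1 - g z.2| ^ 2 * rieszKernel n s z) := by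
  simp only [Hfun, div_eq_mul_rieszKernel]
  congr 1
  have h : ∀ z : EuclideanSpace ℝ (Fin n) × EuclideanSpace ℝ (Fin n),
      ENNReal.ofReal (|pm n E z.1 - pm n E z.2| ^ 2 * rieszKernel n s z) =
        4 * ENNReal.ofReal (|chi n E z.1 - chi n E z.2| * rieszKernel n s z) := by
    intro z
    rw [show (4 : ℝ≥0∞) = ENNReal.ofReal 4 by simp, ← ENNReal.ofReal_mul (by norm_num),
      pm_eq, pm_eq]
    rcases chi_eq_zero_or_one (E := E) z.1 with h1 | h1 <;>
      rcases chi_eq_zero_or_one (E := E) z.2 with h2 | h2 <;> rw [h1, h2] <;> norm_num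
  simp only [h]
  rw [lintegral_const_mul' _ _ (by simp), setLIntegral_abs_chi_sub hΩ hΩ hE,
    interaction_comm (hΩ.diff hE) (hΩ.inter hE)]
  ring

/-- The fractional perimeter in `O ⊆ Ω` and the local part of `H` share a common part, up to
interactions between `O` and `Ωᶜ` for the former and inside `Ω \ O` for the latter. -/
lemma exists_fracPer_eq_add (hE : MeasurableSet E) (hO : MeasurableSet O) (hΩ : MeasurableSet Ω)
    (hOΩ : O ⊆ Ω) : ∃ a : ℝ≥0∞,
      fracPer n s E O = a + (∫⁻ z in O ×ˢ Ωᶜ,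
        ENNReal.ofReal (|chi n E z.1 - chi n E z.2| * rieszKernel n s z)) ∧
      interaction n s ((Ω ∩ E) ×ˢ (Ω \ E)) =
        a + interaction n s (((E \ O) ∩ Ω) ×ˢ (Ω \ (O ∪ E \ O))) := by
  have ha : MeasurableSet (E ∩ O) := hE.inter hO
  have ha' : MeasurableSet (O \ E) := hO.diff hE
  have hb : MeasurableSet ((E \ O) ∩ Ω) := (hE.diff hO).inter hΩ
  have hb' : MeasurableSet (Ω \ (O ∪ E \ O)) := hΩ.diff (hO.union (hE.diff hO))
  have hc : MeasurableSet (E \ Ω) := hE.diff hΩ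
  have hc' : MeasurableSet (Ωᶜ \ E) := hΩ.compl.diff hE
  have e1 : Eᶜ = (O \ E ∪ Ω \ (O ∪ E \ O)) ∪ Ωᶜ \ E := by
    ext x; have := @hOΩ x; simp only [mem_union, Set.mem_sdiff, mem_compl_iff]; tauto
  have e2 : E \ O = (E \ O) ∩ Ω ∪ E \ Ω := by
    ext x; have := @hOΩ x; simp only [mem_union, Set.mem_sdiff, mem_inter_iff]; tauto
  have e3 : Eᶜ ∩ O = O \ E := by
    ext x; simp only [Set.mem_sdiff, mem_inter_iff, mem_compl_iff]; tauto
  have e4 : Ω ∩ E = E ∩ O ∪ (E \ O) ∩ Ω := by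
    ext x; have := @hOΩ x; simp only [mem_union, Set.mem_sdiff, mem_inter_iff]; tauto
  have e5 : Ω \ E = O \ E ∪ Ω \ (O ∪ E \ O) := by
    ext x; have := @hOΩ x; simp only [mem_union, Set.mem_sdiff]; tauto
  have e6 : O ∩ E = E ∩ O := inter_comm _ _
  have e7 : Ωᶜ ∩ E = E \ Ω := by rw [inter_comm]; rfl
  have d1 : Disjoint (O \ E ∪ Ω \ (O ∪ E \ O)) (Ωᶜ \ E) := by
    rw [Set.disjoint_left]; intro x; have := @hOΩ x
    simp only [mem_union, Set.mem_sdiff, mem_compl_iff]; tauto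
  have d2 : Disjoint (O \ E) (Ω \ (O ∪ E \ O)) := by
    rw [Set.disjoint_left]; intro x; simp only [mem_union, Set.mem_sdiff]; tauto
  have d3 : Disjoint ((E \ O) ∩ Ω) (E \ Ω) := by
    rw [Set.disjoint_left]; intro x; simp only [mem_inter_iff, Set.mem_sdiff]; tauto
  have d4 : Disjoint (E ∩ O) ((E \ O) ∩ Ω) := by
    rw [Set.disjoint_left]; intro x; simp only [mem_inter_iff, Set.mem_sdiff]; tauto
  have hper : fracPer n s E O =
      interaction n s ((E ∩ O) ×ˢ (O \ E)) + interaction n s ((E ∩ O) ×ˢ (Ω \ (O ∪ E \ O))) +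
        interaction n s ((E ∩ O) ×ˢ (Ωᶜ \ E)) +
      (interaction n s (((E \ O) ∩ Ω) ×ˢ (O \ E)) + interaction n s ((E \ Ω) ×ˢ (O \ E))) := by
    rw [fracPer_eq hE hO, e3, ← interaction_union_left hc ha' d3, ← e2,
      ← interaction_union_right ha hb' d2, ← interaction_union_right ha hc' d1, ← e1]
  refine ⟨interaction n s ((E ∩ O) ×ˢ (O \ E)) +
    interaction n s ((E ∩ O) ×ˢ (Ω \ (O ∪ E \ O))) +
    interaction n s (((E \ O) ∩ Ω) ×ˢ (O \ E)), ?_, ?_⟩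
  · rw [hper, setLIntegral_abs_chi_sub hO hΩ.compl hE, e6, e7, interaction_comm ha' hc]
    ring
  · rw [e4, e5, interaction_union_left hb (ha'.union hb') d4, interaction_union_right ha hb' d2,
      interaction_union_right hb hb' d2]
    ring

lemma abs_chi_sub_add_sq_le (t : ℝ) (ht : t ∈ Icc (-1 : ℝ) 1)
    (x y : EuclideanSpace ℝ (Fin n)) (hy : chi n E y = chi n F y) :
    |chi n E x - chi n E y| + |pm n F x - t| ^ 2 / 4 ≤
      |chi n F x - chi n F y| + |pm n E x - t| ^ 2 / 4 + 6 * |chi n E x - chi n F x| := by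
  obtain ⟨h1, h2⟩ := ht
  rw [hy, pm_eq, pm_eq, sq_abs, sq_abs]
  rcases chi_eq_zero_or_one (E := E) x with hx | hx <;>
    rcases chi_eq_zero_or_one (E := F) x with hx' | hx' <;>
    rcases chi_eq_zero_or_one (E := F) y with hy' | hy' <;>
    rw [hx, hx', hy'] <;> norm_num <;> nlinarith

lemma exterior_comparison (g : EuclideanSpace ℝ (Fin n) → ℝ) (hg : Measurable g)
    (hg1 : ∀ x, g x ∈ Icc (-1 : ℝ) 1) (hE : MeasurableSet E) (hF : MeasurableSet F)
    (hOΩ : O ⊆ Ω) (hEF : F \ O = E \ O) :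
    (∫⁻ z in O ×ˢ Ωᶜ, ENNReal.ofReal (|chi n E z.1 - chi n E z.2| * rieszKernel n s z)) +
      (1 / 4 : ℝ≥0∞) * ∫⁻ z in O ×ˢ Ωᶜ,
        ENNReal.ofReal (|pm n F z.1 - g z.2| ^ 2 * rieszKernel n s z) ≤
    (∫⁻ z in O ×ˢ Ωᶜ, ENNReal.ofReal (|chi n F z.1 - chi n F z.2| * rieszKernel n s z)) +
      (1 / 4 : ℝ≥0∞) * (∫⁻ z in O ×ˢ Ωᶜ,
        ENNReal.ofReal (|pm n E z.1 - g z.2| ^ 2 * rieszKernel n s z)) +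
      6 * ∫⁻ z in O ×ˢ Ωᶜ,
        ENNReal.ofReal (|chi n E z.1 - chi n F z.1| * rieszKernel n s z) := by
  have mE := measurable_chi hE
  have mF := measurable_chi hF
  have q : (1 / 4 : ℝ≥0∞) = ENNReal.ofReal (1 / 4) := by
    rw [ENNReal.ofReal_div_of_pos (by norm_num)]; simp
  have q6 : (6 : ℝ≥0∞) = ENNReal.ofReal 6 := by simp
  simp only [pm_eq]
  rw [q, q6, ← lintegral_const_mul' _ _ ENNReal.ofReal_ne_top,
    ← lintegral_const_mul' _ _ ENNReal.ofReal_ne_top,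
    ← lintegral_const_mul' _ _ ENNReal.ofReal_ne_top,
    ← lintegral_add_left (by fun_prop), ← lintegral_add_left (by fun_prop),
    ← lintegral_add_left (by fun_prop)]
  refine setLIntegral_mono (by fun_prop) fun z hz => ?_
  have hk := rieszKernel_nonneg (s := s) z
  have hy : chi n E z.2 = chi n F z.2 := by
    have h2 : z.2 ∉ O := fun h => hz.2 (hOΩ h)
    have h3 := Set.ext_iff.1 hEF z.2
    simp only [Set.mem_sdiff, h2, not_false_eq_true, and_true] at h3
    by_cases h : z.2 ∈ E <;> simp [chi, h3, h]
  have key := mul_le_mul_of_nonneg_right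
    (abs_chi_sub_add_sq_le (g z.2) (hg1 z.2) z.1 z.2 hy) hk
  rw [pm_eq, pm_eq] at key
  rw [← ENNReal.ofReal_mul (by norm_num), ← ENNReal.ofReal_mul (by norm_num),
    ← ENNReal.ofReal_mul (by norm_num), ← ENNReal.ofReal_add (by positivity) (by positivity),
    ← ENNReal.ofReal_add (by positivity) (by positivity),
    ← ENNReal.ofReal_add (by positivity) (by positivity)]
  exact ENNReal.ofReal_le_ofReal (by linarith)

/-- The comparison inequality for sets that agree exactly outside `O`. -/
lemma fracPer_add_Hfun_le (g : EuclideanSpace ℝ (Fin n) → ℝ) (hg : Measurable g)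
    (hg1 : ∀ x, g x ∈ Icc (-1 : ℝ) 1) (hE : MeasurableSet E) (hF : MeasurableSet F)
    (hO : MeasurableSet O) (hΩ : MeasurableSet Ω) (hOΩ : O ⊆ Ω) (hEF : F \ O = E \ O) :
    fracPer n s E O + (1 / 8 : ℝ≥0∞) * Hfun n s Ω g F ≤
      fracPer n s F O + (1 / 8 : ℝ≥0∞) * Hfun n s Ω g E +
        6 * ∫⁻ z in O ×ˢ Ωᶜ,
          ENNReal.ofReal (|chi n E z.1 - chi n F z.1| * rieszKernel n s z) := by
  have hH : ∀ {G : Set (EuclideanSpace ℝ (Fin n))}, MeasurableSet G →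
      (1 / 8 : ℝ≥0∞) * Hfun n s Ω g G = interaction n s ((Ω ∩ G) ×ˢ (Ω \ G)) +
        ((1 / 4 : ℝ≥0∞) * (∫⁻ z in O ×ˢ Ωᶜ,
          ENNReal.ofReal (|pm n G z.1 - g z.2| ^ 2 * rieszKernel n s z)) +
        (1 / 4 : ℝ≥0∞) * ∫⁻ z in (Ω \ O) ×ˢ Ωᶜ,
          ENNReal.ofReal (|pm n G z.1 - g z.2| ^ 2 * rieszKernel n s z)) := by
    intro G hG
    have e8 : (1 / 8 : ℝ≥0∞) * 8 = 1 := ENNReal.div_mul_cancel (by simp) (by simp)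
    have e4 : (1 / 8 : ℝ≥0∞) * 2 = 1 / 4 := by
      rw [← ENNReal.toReal_eq_toReal_iff' (by finiteness) (by finiteness)]
      norm_num
    rw [Hfun_eq g hG hΩ, mul_add, ← mul_assoc, ← mul_assoc, e8, e4, one_mul, ← mul_add,
      ← lintegral_union ((hΩ.diff hO).prod hΩ.compl)
        (Set.disjoint_prod.2 (Or.inl disjoint_sdiff_self_right)),
      ← Set.union_prod, Set.union_sdiff_cancel hOΩ]
  have hout : ∫⁻ z in (Ω \ O) ×ˢ Ωᶜ,
      ENNReal.ofReal (|pm n F z.1 - g z.2| ^ 2 * rieszKernel n s z) =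
      ∫⁻ z in (Ω \ O) ×ˢ Ωᶜ,
        ENNReal.ofReal (|pm n E z.1 - g z.2| ^ 2 * rieszKernel n s z) := by
    refine setLIntegral_congr_fun ((hΩ.diff hO).prod hΩ.compl) fun z hz => ?_
    have h3 := Set.ext_iff.1 hEF z.1
    simp only [Set.mem_sdiff, hz.1.2, not_false_eq_true, and_true] at h3
    by_cases h : z.1 ∈ E <;> simp [pm, h3, h]
  obtain ⟨a, hPE, hLE⟩ := exists_fracPer_eq_add (s := s) hE hO hΩ hOΩ
  obtain ⟨b, hPF, hLF⟩ := exists_fracPer_eq_add (s := s) hF hO hΩ hOΩ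
  rw [hEF] at hLF
  have key := exterior_comparison (s := s) g hg hg1 hE hF hOΩ hEF
  rw [hH hE, hH hF, hout, hPE, hPF, hLE, hLF]
  set B := interaction n s (((E \ O) ∩ Ω) ×ˢ (Ω \ (O ∪ E \ O)))
  set R := (1 / 4 : ℝ≥0∞) * ∫⁻ z in (Ω \ O) ×ˢ Ωᶜ,
    ENNReal.ofReal (|pm n E z.1 - g z.2| ^ 2 * rieszKernel n s z)
  refine le_of_eq_of_le ?_ ((add_le_add (le_refl (a + b + B + R)) key).trans_eq ?_) <;> ring

lemma fracPer_congr (h : E =ᵐ[volume] F) : fracPer n s E O = fracPer n s F O := by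
  unfold fracPer
  rw [Measure.volume_eq_prod]
  congr 1 <;> refine setLIntegral_congr (Measure.set_prod_ae_eq ?_ ?_)
  · exact h.inter ae_eq_rfl
  · exact h.compl
  · exact h.diff ae_eq_rfl
  · exact h.compl.inter ae_eq_rfl

lemma ae_mem_iff_fst (h : E =ᵐ[volume] F) :
    ∀ᵐ z : EuclideanSpace ℝ (Fin n) × EuclideanSpace ℝ (Fin n), z.1 ∈ E ↔ z.1 ∈ F :=
  Measure.quasiMeasurePreserving_fst.ae (Filter.eventuallyEq_set.1 h)

lemma ae_mem_iff_snd (h : E =ᵐ[volume] F) :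
    ∀ᵐ z : EuclideanSpace ℝ (Fin n) × EuclideanSpace ℝ (Fin n), z.2 ∈ E ↔ z.2 ∈ F :=
  Measure.quasiMeasurePreserving_snd.ae (Filter.eventuallyEq_set.1 h)

lemma pm_congr {x : EuclideanSpace ℝ (Fin n)} (h : x ∈ E ↔ x ∈ F) : pm n E x = pm n F x := by
  by_cases hx : x ∈ F <;> simp [pm, h, hx]

lemma chi_congr {x : EuclideanSpace ℝ (Fin n)} (h : x ∈ E ↔ x ∈ F) : chi n E x = chi n F x := by
  by_cases hx : x ∈ F <;> simp [chi, h, hx]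

lemma Hfun_congr (g : EuclideanSpace ℝ (Fin n) → ℝ) (h : E =ᵐ[volume] F) :
    Hfun n s Ω g E = Hfun n s Ω g F := by
  unfold Hfun
  congr 1
  · refine lintegral_congr_ae (ae_restrict_of_ae ?_)
    filter_upwards [ae_mem_iff_fst h, ae_mem_iff_snd h] with z h1 h2
    rw [pm_congr h1, pm_congr h2]
  · congr 1
    refine lintegral_congr_ae (ae_restrict_of_ae ?_)
    filter_upwards [ae_mem_iff_fst h] with z h1
    rw [pm_congr h1]

end

/-- for `Ω' ⋐ Ω` and measurable `E`, `F` with `F \ Ω' = E \ Ω'` (up to a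
null set) and finite Gagliardo energies of `χ_E`, `χ_F` on `Ω×Ω`,
`Per_s(E,Ω') - Per_s(F,Ω') ≤ ⅛ (H(E,Ω) - H(F,Ω)) + 6 ∬_{Ω'×(ℝⁿ\Ω)} |χ_E(x)-χ_F(x)|/|x-y|^{n+2s}`.
(The negative terms have been moved to the other side so the inequality is stated in `ℝ≥0∞`
without truncated subtraction; this is equivalent.) -/
theorem statement5
    (n : ℕ) (hn : 1 ≤ n) (s : ℝ) (hs : 0 < s) (hs' : s < 1 / 2)
    (Ω : Set (EuclideanSpace ℝ (Fin n))) (hΩo : IsOpen Ω) (hΩb : Bornology.IsBounded Ω)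
    (g : EuclideanSpace ℝ (Fin n) → ℝ) (hg : Continuous g)
    (hg1 : ∀ x, g x ∈ Icc (-1 : ℝ) 1)
    (Ω' : Set (EuclideanSpace ℝ (Fin n))) (hΩ'o : IsOpen Ω') (hΩ'c : closure Ω' ⊆ Ω)
    (hΩ'k : IsCompact (closure Ω'))
    (E F : Set (EuclideanSpace ℝ (Fin n))) (hE : MeasurableSet E) (hF : MeasurableSet F)
    (hEF : volume ((F \ Ω') ∆ (E \ Ω')) = 0)
    (hfinE : Jset n s (Ω ×ˢ Ω) (chi n E) ≠ ⊤)
    (hfinF : Jset n s (Ω ×ˢ Ω) (chi n F) ≠ ⊤) :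
    fracPer n s E Ω' + (1 / 8 : ℝ≥0∞) * Hfun n s Ω g F ≤
      fracPer n s F Ω' + (1 / 8 : ℝ≥0∞) * Hfun n s Ω g E +
        6 * ∫⁻ z : EuclideanSpace ℝ (Fin n) × EuclideanSpace ℝ (Fin n) in Ω' ×ˢ Ωᶜ,
          ENNReal.ofReal (|chi n E z.1 - chi n F z.1| / ‖z.1 - z.2‖ ^ ((n : ℝ) + 2 * s)) := by
  have hmO := hΩ'o.measurableSet
  have hFG : F =ᵐ[volume] (F ∩ Ω' ∪ E \ Ω' : Set (EuclideanSpace ℝ (Fin n))) := by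
    conv_lhs => rw [← Set.inter_union_sdiff F Ω']
    exact ae_eq_rfl.union (measure_symmDiff_eq_zero_iff.1 hEF)
  have hd : (F ∩ Ω' ∪ E \ Ω') \ Ω' = E \ Ω' := by
    ext x; simp only [mem_union, Set.mem_sdiff, mem_inter_iff]; tauto
  have key := fracPer_add_Hfun_le (s := s) g hg.measurable hg1 hE
    ((hF.inter hmO).union (hE.diff hmO)) hmO hΩo.measurableSet (subset_closure.trans hΩ'c) hd
  have hD : ∫⁻ z in Ω' ×ˢ Ωᶜ, ENNReal.ofReal
        (|chi n E z.1 - chi n (F ∩ Ω' ∪ E \ Ω') z.1| * rieszKernel n s z) =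
      ∫⁻ z in Ω' ×ˢ Ωᶜ,
        ENNReal.ofReal (|chi n E z.1 - chi n F z.1| * rieszKernel n s z) := by
    refine lintegral_congr_ae (ae_restrict_of_ae ?_)
    filter_upwards [ae_mem_iff_fst hFG] with z h1
    rw [chi_congr h1]
  simp only [div_eq_mul_rieszKernel]
  rwa [hD, ← fracPer_congr hFG, ← Hfun_congr g hFG] at key
end
end

section
/- Let s ∈ (0,1/2), p ∈ [0,1], a ∈ (0,1) and b > 0. Let ū : ℝ → [−1,1] be measurable with ū = −1 a.e. on (p−a, p) and ū ≥ −1+b a.e. on (p, p+a). Then there exist ς > 0 and δ₀ ∈ (0, a/2), depending only on s, a and b, such that for every δ ∈ (0, δ₀) there is a measurable function u_δ : ℝ → [−1,1] with u_δ = ū on ℝ \ (p−δ, p) and u_δ(Q_{(−1,1)}) ≤ ū(Q_{(−1,1)}) − ς δ^{1−2s}. (One may take u_δ = ū + (b/2) χ_{(p−δ,p)}.) -/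
open MeasureTheory Filter Set
open scoped ENNReal NNReal Topology

noncomputable section

/-- The one-dimensional kinetic energy of `u : ℝ → ℝ` over
`Q_{(-1,1)} = (ℝ × ℝ) \ (((-1,1))ᶜ × ((-1,1))ᶜ)` with fractional parameter `s`. -/
def JQ1 (s : ℝ) (u : ℝ → ℝ) : ℝ≥0∞ :=
  ∫⁻ z : ℝ × ℝ in ((Ioo (-1 : ℝ) 1)ᶜ ×ˢ (Ioo (-1 : ℝ) 1)ᶜ)ᶜ,
    ENNReal.ofReal (|u z.1 - u z.2| ^ 2 / |z.1 - z.2| ^ (1 + 2 * s))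

/-- The translation-invariant kernel `|t|^{-1-2s}` as an extended nonnegative function. -/
def fracKernel (s t : ℝ) : ℝ≥0∞ := ENNReal.ofReal (1 / |t| ^ (1 + 2 * s))

lemma measurable_fracKernel (s : ℝ) : Measurable (fracKernel s) := by
  unfold fracKernel
  fun_prop

lemma fracKernel_neg (s t : ℝ) : fracKernel s (-t) = fracKernel s t := by
  simp [fracKernel]

lemma measurable_fracKernel_sub (s : ℝ) :
    Measurable fun z : ℝ × ℝ => fracKernel s (z.1 - z.2) :=
  (measurable_fracKernel s).comp (measurable_fst.sub measurable_snd)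

lemma lintegral_fracKernel_Ici {s q : ℝ} (hs : 0 < s) (hq : 0 < q) :
    ∫⁻ t in Ici q, fracKernel s t = ENNReal.ofReal (q ^ (-(2 * s)) / (2 * s)) := by
  rw [setLIntegral_congr Ioi_ae_eq_Ici.symm]
  have hlt : -(1 + 2 * s) < -1 := by linarith
  have h1 : ∫⁻ t in Ioi q, fracKernel s t
      = ∫⁻ t in Ioi q, ENNReal.ofReal (t ^ (-(1 + 2 * s))) := by
    refine setLIntegral_congr_fun measurableSet_Ioi fun t ht => ?_
    have ht' : 0 < t := hq.trans ht
    simp only [fracKernel]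
    rw [abs_of_pos ht', Real.rpow_neg ht'.le, one_div]
  rw [h1, ← ofReal_integral_eq_lintegral_ofReal (integrableOn_Ioi_rpow_of_lt hlt hq),
    integral_Ioi_rpow_of_lt hlt hq]
  · congr 1
    rw [show -(1 + 2 * s) + 1 = -(2 * s) by ring, neg_div_neg_eq]
  · filter_upwards [ae_restrict_mem measurableSet_Ioi] with t ht
    exact Real.rpow_nonneg (hq.trans ht).le _

lemma setLIntegral_sub_right (f : ℝ → ℝ≥0∞) (x : ℝ) {A B : Set ℝ} (hA : MeasurableSet A)
    (hB : MeasurableSet B) (h : ∀ y, y ∈ A ↔ y - x ∈ B) :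
    ∫⁻ y in A, f (y - x) = ∫⁻ t in B, f t := by
  rw [← lintegral_indicator hA, ← lintegral_indicator hB,
    ← lintegral_sub_right_eq_self (B.indicator f) x]
  congr 1
  ext y
  by_cases hy : y ∈ A
  · rw [indicator_of_mem hy, indicator_of_mem ((h y).1 hy)]
  · rw [indicator_of_notMem hy, indicator_of_notMem (mt (h y).2 hy)]

lemma setLIntegral_sub_left (f : ℝ → ℝ≥0∞) (x : ℝ) {A B : Set ℝ} (hA : MeasurableSet A)
    (hB : MeasurableSet B) (h : ∀ y, y ∈ A ↔ x - y ∈ B) :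
    ∫⁻ y in A, f (x - y) = ∫⁻ t in B, f t := by
  rw [← lintegral_indicator hA, ← lintegral_indicator hB,
    ← lintegral_sub_left_eq_self (B.indicator f) x]
  congr 1
  ext y
  by_cases hy : y ∈ A
  · rw [indicator_of_mem hy, indicator_of_mem ((h y).1 hy)]
  · rw [indicator_of_notMem hy, indicator_of_notMem (mt (h y).2 hy)]

lemma lintegral_fracKernel_sub_Ici {s x q : ℝ} (hs : 0 < s) (hq : x < q) :
    ∫⁻ y in Ici q, fracKernel s (x - y)
      = ENNReal.ofReal ((q - x) ^ (-(2 * s)) / (2 * s)) := by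
  rw [← lintegral_fracKernel_Ici hs (sub_pos.2 hq),
    ← setLIntegral_sub_right (fracKernel s) x measurableSet_Ici measurableSet_Ici
      (A := Ici q) (by simp)]
  simp_rw [← fracKernel_neg s (_ - x), neg_sub]

lemma lintegral_fracKernel_sub_Iic {s x q : ℝ} (hs : 0 < s) (hq : q < x) :
    ∫⁻ y in Iic q, fracKernel s (x - y)
      = ENNReal.ofReal ((x - q) ^ (-(2 * s)) / (2 * s)) := by
  rw [← lintegral_fracKernel_Ici hs (sub_pos.2 hq),
    ← setLIntegral_sub_left (fracKernel s) x measurableSet_Iic measurableSet_Ici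
      (A := Iic q) (fun y => (sub_le_sub_iff_left x).symm)]

lemma lintegral_Ioo_rpow {s d : ℝ} (hs : 0 < s) (hs' : s < 1 / 2) (hd : 0 < d) :
    ∫⁻ t in Ioo 0 d, ENNReal.ofReal (t ^ (-(2 * s)) / (2 * s))
      = ENNReal.ofReal (d ^ (1 - 2 * s) / (2 * s * (1 - 2 * s))) := by
  have hlt : -1 < -(2 * s) := by linarith
  have hI : IntegrableOn (fun t : ℝ => t ^ (-(2 * s)) / (2 * s)) (Ioc 0 d) :=
    ((intervalIntegrable_iff_integrableOn_Ioc_of_le hd.le).1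
      (intervalIntegral.intervalIntegrable_rpow' hlt)).div_const _
  rw [setLIntegral_congr Ioo_ae_eq_Ioc, ← ofReal_integral_eq_lintegral_ofReal hI,
    ← intervalIntegral.integral_of_le hd.le, intervalIntegral.integral_div,
    integral_rpow (Or.inl hlt)]
  · congr 1
    rw [show -(2 * s) + 1 = 1 - 2 * s by ring, Real.zero_rpow (by linarith), sub_zero,
      div_div, mul_comm (2 * s)]
  · filter_upwards [ae_restrict_mem measurableSet_Ioc] with t ht
    have := Real.rpow_nonneg ht.1.le (-(2 * s))
    positivity

lemma lintegral_prod_fracKernel_right {s p d : ℝ} (hs : 0 < s) (hs' : s < 1 / 2) (hd : 0 < d) :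
    ∫⁻ x in Ioo (p - d) p, ∫⁻ y in Ici p, fracKernel s (x - y)
      = ENNReal.ofReal (d ^ (1 - 2 * s) / (2 * s * (1 - 2 * s))) := by
  rw [← lintegral_Ioo_rpow hs hs' hd, setLIntegral_congr_fun measurableSet_Ioo
    fun x hx => lintegral_fracKernel_sub_Ici hs hx.2]
  refine setLIntegral_sub_left (fun t => ENNReal.ofReal (t ^ (-(2 * s)) / (2 * s))) p
    measurableSet_Ioo measurableSet_Ioo fun y => ?_
  constructor <;> rintro ⟨h1, h2⟩ <;> constructor <;> linarith

lemma lintegral_prod_fracKernel_left {s p d : ℝ} (hs : 0 < s) (hs' : s < 1 / 2) (hd : 0 < d) :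
    ∫⁻ x in Ioo (p - d) p, ∫⁻ y in Iic (p - d), fracKernel s (x - y)
      = ENNReal.ofReal (d ^ (1 - 2 * s) / (2 * s * (1 - 2 * s))) := by
  rw [← lintegral_Ioo_rpow hs hs' hd, setLIntegral_congr_fun measurableSet_Ioo
    fun x hx => lintegral_fracKernel_sub_Iic hs hx.1]
  refine setLIntegral_sub_right (fun t => ENNReal.ofReal (t ^ (-(2 * s)) / (2 * s))) (p - d)
    measurableSet_Ioo measurableSet_Ioo fun y => ?_
  constructor <;> rintro ⟨h1, h2⟩ <;> constructor <;> linarith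

lemma lintegral_prod_fracKernel_far_le {s p a d : ℝ} (hs : 0 < s) (ha : 0 < a) :
    ∫⁻ x in Ioo (p - d) p, ∫⁻ y in Ici (p + a), fracKernel s (x - y)
      ≤ ENNReal.ofReal (d * a ^ (-(2 * s)) / (2 * s)) := by
  calc ∫⁻ x in Ioo (p - d) p, ∫⁻ y in Ici (p + a), fracKernel s (x - y)
      ≤ ∫⁻ _ in Ioo (p - d) p, ENNReal.ofReal (a ^ (-(2 * s)) / (2 * s)) := by
        refine setLIntegral_mono measurable_const fun x hx => ?_
        rw [lintegral_fracKernel_sub_Ici hs (by linarith [hx.2])]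
        refine ENNReal.ofReal_le_ofReal (div_le_div_of_nonneg_right ?_ (by positivity))
        exact Real.rpow_le_rpow_of_nonpos ha (by linarith [hx.2]) (by linarith)
    _ = ENNReal.ofReal (d * a ^ (-(2 * s)) / (2 * s)) := by
        rw [setLIntegral_const, Real.volume_Ioo, ← ENNReal.ofReal_mul (by positivity)]
        congr 1
        ring

/-- If `d` is small compared to `a`, the interaction of `(p - d, p)` with the interval
`[p, p + a)` on its right dominates a third of its interaction with the rest of the line,
with a gain of order `d ^ (1 - 2 * s)`. -/
lemma lintegral_fracKernel_gain {s p a d : ℝ} (hs : 0 < s) (hs' : s < 1 / 2) (ha : 0 < a)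
    (hd : 0 < d) (hda : 4 * d ^ (2 * s) ≤ a ^ (2 * s)) :
    (∫⁻ x in Ioo (p - d) p, ∫⁻ y in (Ioo (p - d) (p + a))ᶜ, fracKernel s (x - y)) ≠ ⊤ ∧
    (∫⁻ x in Ioo (p - d) p, ∫⁻ y in (Ioo (p - d) (p + a))ᶜ, fracKernel s (x - y))
        + ENNReal.ofReal (d ^ (1 - 2 * s) / (2 * s * (1 - 2 * s)))
      ≤ 3 * ∫⁻ x in Ioo (p - d) p, ∫⁻ y in Ico p (p + a), fracKernel s (x - y) := by
  have hm : ∀ S : Set ℝ, Measurable fun x => ∫⁻ y in S, fracKernel s (x - y) := fun S =>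
    (measurable_fracKernel_sub s).lintegral_prod_right'
  have h1 : ENNReal.ofReal (d ^ (1 - 2 * s) / (2 * s * (1 - 2 * s))) ≤
      (∫⁻ x in Ioo (p - d) p, ∫⁻ y in Ico p (p + a), fracKernel s (x - y)) +
      ∫⁻ x in Ioo (p - d) p, ∫⁻ y in Ici (p + a), fracKernel s (x - y) := by
    rw [← lintegral_prod_fracKernel_right (p := p) hs hs' hd, ← lintegral_add_left (hm _)]
    refine lintegral_mono fun x => ?_
    rw [← Ico_union_Ici_eq_Ici (show p ≤ p + a by linarith)]
    exact lintegral_union_le _ _ _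
  have h2 : (∫⁻ x in Ioo (p - d) p, ∫⁻ y in (Ioo (p - d) (p + a))ᶜ, fracKernel s (x - y)) ≤
      ENNReal.ofReal (d ^ (1 - 2 * s) / (2 * s * (1 - 2 * s))) +
      ∫⁻ x in Ioo (p - d) p, ∫⁻ y in Ici (p + a), fracKernel s (x - y) := by
    rw [← lintegral_prod_fracKernel_left (p := p) hs hs' hd, ← lintegral_add_left (hm _)]
    refine lintegral_mono fun x => ?_
    refine le_trans (lintegral_mono_set fun y hy => ?_) (lintegral_union_le _ _ _)
    simp only [mem_compl_iff, mem_Ioo, not_and, not_lt] at hy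
    rcases le_or_gt y (p - d) with h | h
    · exact Or.inl h
    · exact Or.inr (hy h)
  have h3 := lintegral_prod_fracKernel_far_le (p := p) (d := d) hs ha
  have h4 : 4 * (d * a ^ (-(2 * s)) / (2 * s)) ≤ d ^ (1 - 2 * s) / (2 * s * (1 - 2 * s)) := by
    have hap : 0 < a ^ (2 * s) := Real.rpow_pos_of_pos ha _
    have hdp : 0 < d ^ (2 * s) := Real.rpow_pos_of_pos hd _
    have h1s : 0 < 1 - 2 * s := by linarith
    rw [Real.rpow_neg ha.le, Real.rpow_sub hd, Real.rpow_one]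
    have e1 : 4 * (d * (a ^ (2 * s))⁻¹ / (2 * s)) = d / (2 * s) * (4 / a ^ (2 * s)) := by
      field_simp
    have e2 : d / d ^ (2 * s) / (2 * s * (1 - 2 * s))
        = d / (2 * s) * (1 / (d ^ (2 * s) * (1 - 2 * s))) := by
      field_simp
    rw [e1, e2]
    refine mul_le_mul_of_nonneg_left ?_ (by positivity)
    rw [div_le_div_iff₀ hap (by positivity)]
    nlinarith
  generalize (∫⁻ x in Ioo (p - d) p, ∫⁻ y in Ici (p + a), fracKernel s (x - y)) = B at *
  generalize (∫⁻ x in Ioo (p - d) p, ∫⁻ y in (Ioo (p - d) (p + a))ᶜ,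
    fracKernel s (x - y)) = M at *
  generalize (∫⁻ x in Ioo (p - d) p, ∫⁻ y in Ico p (p + a), fracKernel s (x - y)) = N at *
  have h5 : 4 * B ≤ ENNReal.ofReal (d ^ (1 - 2 * s) / (2 * s * (1 - 2 * s))) := by
    refine le_trans (mul_le_mul_right h3 4) ?_
    rw [← ENNReal.ofReal_ofNat 4, ← ENNReal.ofReal_mul (by norm_num)]
    exact ENNReal.ofReal_le_ofReal h4
  have hB : B ≠ ⊤ := ne_top_of_le_ne_top ENNReal.ofReal_ne_top h3
  have hA : ENNReal.ofReal (d ^ (1 - 2 * s) / (2 * s * (1 - 2 * s))) ≠ ⊤ :=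
    ENNReal.ofReal_ne_top
  generalize ENNReal.ofReal (d ^ (1 - 2 * s) / (2 * s * (1 - 2 * s))) = A at *
  have hM : M ≠ ⊤ := ne_top_of_le_ne_top (ENNReal.add_ne_top.2 ⟨hA, hB⟩) h2
  refine ⟨hM, ?_⟩
  by_cases hN : N = ⊤
  · simp [hN]
  lift A to ℝ≥0 using hA
  lift B to ℝ≥0 using hB
  lift M to ℝ≥0 using hM
  lift N to ℝ≥0 using hN
  norm_cast at h1 h2 h5 ⊢
  rw [← NNReal.coe_le_coe] at h1 h2 h5 ⊢
  push_cast at h1 h2 h5 ⊢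
  linarith

lemma JQ1_integrand_eq (s v t : ℝ) :
    ENNReal.ofReal (|v| ^ 2 / |t| ^ (1 + 2 * s)) = ENNReal.ofReal (v ^ 2) * fracKernel s t := by
  rw [fracKernel, ← ENNReal.ofReal_mul (sq_nonneg v), sq_abs, mul_one_div]

lemma ofReal_sq_mul_add_le {v w x y : ℝ} (k : ℝ≥0∞) (hx : 0 ≤ x) (hy : 0 ≤ y)
    (h : v ^ 2 + x ≤ w ^ 2 + y) :
    ENNReal.ofReal (v ^ 2) * k + ENNReal.ofReal x * k
      ≤ ENNReal.ofReal (w ^ 2) * k + ENNReal.ofReal y * k := by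
  rw [← add_mul, ← add_mul, ← ENNReal.ofReal_add (sq_nonneg v) hx,
    ← ENNReal.ofReal_add (sq_nonneg w) hy]
  exact mul_le_mul_left (ENNReal.ofReal_le_ofReal h) k

lemma lintegral_indicator_prod_symm (s : ℝ) {D P : Set ℝ} (hD : MeasurableSet D)
    (hP : MeasurableSet P) (r : ℝ≥0∞) :
    (∫⁻ z : ℝ × ℝ, ((D ×ˢ P) ∪ (P ×ˢ D)).indicator
        (fun z => r * fracKernel s (z.1 - z.2)) z)
      ≤ r * (2 * ∫⁻ x in D, ∫⁻ y in P, fracKernel s (x - y)) ∧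
    (Disjoint D P → (∫⁻ z : ℝ × ℝ, ((D ×ˢ P) ∪ (P ×ˢ D)).indicator
        (fun z => r * fracKernel s (z.1 - z.2)) z)
      = r * (2 * ∫⁻ x in D, ∫⁻ y in P, fracKernel s (x - y))) := by
  have hk := measurable_fracKernel_sub s
  have e1 : ∫⁻ z in D ×ˢ P, fracKernel s (z.1 - z.2)
      = ∫⁻ x in D, ∫⁻ y in P, fracKernel s (x - y) :=
    setLIntegral_prod _ hk.aemeasurable
  have e2 : ∫⁻ z in P ×ˢ D, fracKernel s (z.1 - z.2)
      = ∫⁻ x in D, ∫⁻ y in P, fracKernel s (x - y) := by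
    rw [Measure.volume_eq_prod, setLIntegral_prod_symm _ hk.aemeasurable]
    refine lintegral_congr fun x => lintegral_congr fun y => ?_
    rw [← fracKernel_neg, neg_sub]
  rw [lintegral_indicator ((hD.prod hP).union (hP.prod hD)), lintegral_const_mul _ hk, two_mul]
  constructor
  · refine mul_le_mul_right ((lintegral_union_le _ _ _).trans ?_) _
    rw [e1, e2]
  · intro h
    rw [lintegral_union (hP.prod hD) (Disjoint.set_prod_left h _ _), e1, e2]

/-- Raising `u` from `-1` to `-1 + c` on `(p - d, p)` decreases the energy as soon as
`u ≥ -1 + 2c` on `[p, p + a)`, up to the interaction with the remaining points. -/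
lemma JQ1_piecewise_add_le {s p a c d : ℝ} (ha : 0 < a) (hd : 0 < d)
    (hsub : Ioo (p - d) p ⊆ Ioo (-1 : ℝ) 1) (hc : 0 ≤ c) {u : ℝ → ℝ} (hu : Measurable u)
    (hge : ∀ x, -1 ≤ u x) (hleft : ∀ᵐ x, x ∈ Ioo (p - d) p → u x = -1)
    (hright : ∀ᵐ x, x ∈ Ico p (p + a) → -1 + 2 * c ≤ u x) :
    JQ1 s ((Ioo (p - d) p).piecewise (fun _ => -1 + c) u)
        + ENNReal.ofReal (3 * c ^ 2) *
          (2 * ∫⁻ x in Ioo (p - d) p, ∫⁻ y in Ico p (p + a), fracKernel s (x - y))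
      ≤ JQ1 s u + ENNReal.ofReal (c ^ 2) *
          (2 * ∫⁻ x in Ioo (p - d) p, ∫⁻ y in (Ioo (p - d) (p + a))ᶜ, fracKernel s (x - y)) := by
  set D := Ioo (p - d) p
  set P := Ico p (p + a)
  set R := (Ioo (p - d) (p + a))ᶜ
  set v := D.piecewise (fun _ => -1 + c) u
  have hvm : Measurable v := measurable_const.piecewise measurableSet_Ioo hu
  set Q := ((Ioo (-1 : ℝ) 1)ᶜ ×ˢ (Ioo (-1 : ℝ) 1)ᶜ)ᶜ
  have hQm : MeasurableSet Q :=
    (measurableSet_Ioo.compl.prod measurableSet_Ioo.compl).compl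
  have hk := measurable_fracKernel_sub s
  have hJ : ∀ w : ℝ → ℝ, JQ1 s w = ∫⁻ z : ℝ × ℝ, Q.indicator (fun z =>
      ENNReal.ofReal ((w z.1 - w z.2) ^ 2) * fracKernel s (z.1 - z.2)) z := by
    intro w
    rw [lintegral_indicator hQm, JQ1]
    exact lintegral_congr fun z => JQ1_integrand_eq s _ _
  have hJm : ∀ w : ℝ → ℝ, Measurable w → Measurable (Q.indicator (fun z : ℝ × ℝ =>
      ENNReal.ofReal ((w z.1 - w z.2) ^ 2) * fracKernel s (z.1 - z.2))) := by
    intro w hw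
    refine Measurable.indicator (Measurable.mul ?_ hk) hQm
    exact (((hw.comp measurable_fst).sub (hw.comp measurable_snd)).pow_const 2).ennreal_ofReal
  have hdisj : Disjoint D P := by
    rw [Set.disjoint_left]
    exact fun x hx hx' => absurd hx.2 (not_lt.2 hx'.1)
  rw [← (lintegral_indicator_prod_symm s (D := D) (P := P) measurableSet_Ioo measurableSet_Ico _).2 hdisj, hJ, hJ,
    ← lintegral_add_left (hJm v hvm)]
  refine le_trans ?_ (add_le_add_right
    (lintegral_indicator_prod_symm s (D := D) (P := R) measurableSet_Ioo
      measurableSet_Ioo.compl _).1 _)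
  rw [← lintegral_add_left (hJm u hu)]
  have hfst : ∀ {q : ℝ → Prop}, (∀ᵐ x, q x) → ∀ᵐ z : ℝ × ℝ, q z.1 := fun h =>
    Measure.quasiMeasurePreserving_fst.ae h
  have hsnd : ∀ {q : ℝ → Prop}, (∀ᵐ x, q x) → ∀ᵐ z : ℝ × ℝ, q z.2 := fun h =>
    Measure.quasiMeasurePreserving_snd.ae h
  refine lintegral_mono_ae ?_
  filter_upwards [hfst hleft, hsnd hleft, hfst hright, hsnd hright] with ⟨x, y⟩ hx hy hx' hy'
  simp only at hx hy hx' hy'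
  have hvin : ∀ t, t ∈ D → v t = -1 + c := fun t ht => piecewise_eq_of_mem _ _ _ ht
  have hvout : ∀ t, t ∉ D → v t = u t := fun t ht => piecewise_eq_of_notMem _ _ _ ht
  have hDP : ∀ t, t ∈ D → t ∉ P := fun t ht ht' => Set.disjoint_left.1 hdisj ht ht'
  have hDR : ∀ t, t ∈ D → t ∉ R := fun t ht ht' => ht' ⟨ht.1, by linarith [ht.2]⟩
  have hPR : ∀ t, t ∉ D → (t ∈ P ↔ t ∉ R) := by
    intro t ht
    refine ⟨fun h h' => h' ⟨by linarith [h.1], h.2⟩, fun h => ?_⟩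
    rw [notMem_compl_iff] at h
    exact ⟨not_lt.1 fun h' => ht ⟨h.1, h'⟩, h.2⟩
  have hQx : x ∈ D → (x, y) ∈ Q := fun h h' => h'.1 (hsub h)
  have hQy : y ∈ D → (x, y) ∈ Q := fun h h' => h'.2 (hsub h)
  clear_value v Q R P D
  have hux := hge x
  have huy := hge y
  have hcc := mul_nonneg hc hc
  by_cases hxD : x ∈ D
  · by_cases hyD : y ∈ D
    · have h1 := hDP x hxD
      have h2 := hDR x hxD
      have h3 := hDP y hyD
      have h4 := hDR y hyD
      simp [indicator, h1, h2, h3, h4, hvin, hxD, hyD]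
    · by_cases hyP : y ∈ P
      · have h1 := (hPR y hyD).1 hyP
        have := ofReal_sq_mul_add_le (v := v x - v y) (w := u x - u y) (x := 3 * c ^ 2)
          (y := 0) (fracKernel s (x - y)) (by positivity) le_rfl (by
            rw [hvin x hxD, hvout y hyD, hx hxD]
            nlinarith [hy' hyP])
        simpa [indicator, h1, hxD, hyD, hyP, hQx hxD] using this
      · have h1 : y ∈ R := by
          by_contra h
          exact hyP ((hPR y hyD).2 h)
        have := ofReal_sq_mul_add_le (v := v x - v y) (w := u x - u y) (x := 0)
          (y := c ^ 2) (fracKernel s (x - y)) le_rfl (by positivity) (by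
            rw [hvin x hxD, hvout y hyD, hx hxD]
            nlinarith)
        simpa [indicator, h1, hxD, hyD, hyP, hQx hxD] using this
  · by_cases hyD : y ∈ D
    · by_cases hxP : x ∈ P
      · have h1 := (hPR x hxD).1 hxP
        have := ofReal_sq_mul_add_le (v := v x - v y) (w := u x - u y) (x := 3 * c ^ 2)
          (y := 0) (fracKernel s (x - y)) (by positivity) le_rfl (by
            rw [hvin y hyD, hvout x hxD, hy hyD]
            nlinarith [hx' hxP])
        simpa [indicator, h1, hxD, hyD, hxP, hQy hyD] using this
      · have h1 : x ∈ R := by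
          by_contra h
          exact hxP ((hPR x hxD).2 h)
        have := ofReal_sq_mul_add_le (v := v x - v y) (w := u x - u y) (x := 0)
          (y := c ^ 2) (fracKernel s (x - y)) le_rfl (by positivity) (by
            rw [hvin y hyD, hvout x hxD, hy hyD]
            nlinarith)
        simpa [indicator, h1, hxD, hyD, hxP, hQy hyD] using this
    · simp [indicator, hxD, hyD, hvout x hxD, hvout y hyD]

/-- Proposition A.1: let `s ∈ (0,1/2)`, `a ∈ (0,1)`, `b > 0`. There exist
`ς > 0` and `δ₀ ∈ (0,a/2)`, depending only on `s`, `a`, `b`, such that for every `p ∈ [0,1]`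
and every measurable `ū : ℝ → [-1,1]` with finite kinetic energy, `ū = -1` a.e. on
`(p-a,p)` and `ū ≥ -1+b` a.e. on `(p,p+a)`, and every `δ ∈ (0,δ₀)`, there is a measurable
`u_δ : ℝ → [-1,1]` with `u_δ = ū` outside `(p-δ,p)` and
`u_δ(Q_{(-1,1)}) ≤ ū(Q_{(-1,1)}) - ς δ^{1-2s}`. -/
theorem statement14
    (s : ℝ) (hs : 0 < s) (hs' : s < 1 / 2)
    (a : ℝ) (ha : a ∈ Ioo (0 : ℝ) 1) (b : ℝ) (hb : 0 < b) :
    ∃ ς > (0 : ℝ), ∃ δ₀ : ℝ, 0 < δ₀ ∧ δ₀ < a / 2 ∧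
      ∀ p ∈ Icc (0 : ℝ) 1,
      ∀ ubar : ℝ → ℝ, Measurable ubar → (∀ x, ubar x ∈ Icc (-1 : ℝ) 1) →
        JQ1 s ubar ≠ ⊤ →
        (∀ᵐ x ∂(volume.restrict (Ioo (p - a) p)), ubar x = -1) →
        (∀ᵐ x ∂(volume.restrict (Ioo p (p + a))), -1 + b ≤ ubar x) →
      ∀ δ : ℝ, 0 < δ → δ < δ₀ →
        ∃ udelta : ℝ → ℝ, Measurable udelta ∧ (∀ x, udelta x ∈ Icc (-1 : ℝ) 1) ∧
          (∀ x ∉ Ioo (p - δ) p, udelta x = ubar x) ∧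
          JQ1 s udelta ≠ ⊤ ∧
          (JQ1 s udelta).toReal ≤ (JQ1 s ubar).toReal - ς * δ ^ (1 - 2 * s) := by
  obtain ⟨ha0, ha1⟩ := ha
  have h1s : 0 < 1 - 2 * s := by linarith
  set θ : ℝ := (4 : ℝ) ^ (-(1 / (2 * s))) with hθ
  have hθ0 : 0 < θ := Real.rpow_pos_of_pos (by norm_num) _
  have hθs : θ ^ (2 * s) = 1 / 4 := by
    rw [hθ, ← Real.rpow_mul (by norm_num), show -(1 / (2 * s)) * (2 * s) = -1 by field_simp,
      Real.rpow_neg_one]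
    norm_num
  have hθ2 : θ < 1 / 2 := by
    have : θ ≤ (4 : ℝ) ^ (-1 : ℝ) := by
      refine Real.rpow_le_rpow_of_exponent_le (by norm_num) ?_
      rw [neg_le_neg_iff, le_div_iff₀ (by linarith)]
      linarith
    rw [Real.rpow_neg_one] at this
    linarith
  refine ⟨(b / 2) ^ 2 / (s * (1 - 2 * s)), by positivity, a * θ, by positivity, by nlinarith, ?_⟩
  intro p hp u hu hu1 hJ hleft hright d hd hda
  have hda2 : d < a / 2 := by nlinarith
  have hpow : 4 * d ^ (2 * s) ≤ a ^ (2 * s) := by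
    have := Real.rpow_le_rpow hd.le hda.le (show 0 ≤ 2 * s by linarith)
    rw [Real.mul_rpow ha0.le hθ0.le, hθs] at this
    linarith
  rw [ae_restrict_iff' measurableSet_Ioo] at hleft
  rw [restrict_Ioo_eq_restrict_Ico, ae_restrict_iff' measurableSet_Ico] at hright
  have hb2 : b ≤ 2 := by
    by_contra! h
    have hnull : volume (Ico p (p + a)) = 0 := by
      refine measure_mono_null (fun x hx => ?_) hright
      intro hxb
      linarith [hxb hx, (hu1 x).2]
    rw [Real.volume_Ico, ENNReal.ofReal_eq_zero] at hnull
    linarith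
  have key := JQ1_piecewise_add_le (s := s) (p := p) (a := a) (c := b / 2) (d := d) ha0 hd
    (Ioo_subset_Ioo (by linarith [hp.1]) hp.2) (by positivity) hu (fun x => (hu1 x).1)
    (hleft.mono fun x hx hxd => hx ⟨by linarith [hxd.1], hxd.2⟩)
    (hright.mono fun x hx hxp => by linarith [hx hxp])
  obtain ⟨hM, hgain⟩ := lintegral_fracKernel_gain (p := p) hs hs' ha0 hd hpow
  refine ⟨(Ioo (p - d) p).piecewise (fun _ => -1 + b / 2) u,
    measurable_const.piecewise measurableSet_Ioo hu, fun x => ?_,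
    fun x hx => piecewise_eq_of_notMem _ _ _ hx, ?_⟩
  · by_cases hx : x ∈ Ioo (p - d) p
    · rw [piecewise_eq_of_mem _ _ _ hx]
      constructor <;> linarith
    · rw [piecewise_eq_of_notMem _ _ _ hx]
      exact hu1 x
  generalize JQ1 s ((Ioo (p - d) p).piecewise (fun _ => -1 + b / 2) u) = V at *
  generalize JQ1 s u = U at *
  generalize (∫⁻ x in Ioo (p - d) p, ∫⁻ y in (Ioo (p - d) (p + a))ᶜ,
    fracKernel s (x - y)) = M at *
  generalize (∫⁻ x in Ioo (p - d) p, ∫⁻ y in Ico p (p + a), fracKernel s (x - y)) = N at *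
  have htop : U + ENNReal.ofReal ((b / 2) ^ 2) * (2 * M) ≠ ⊤ :=
    ENNReal.add_ne_top.2 ⟨hJ, ENNReal.mul_ne_top ENNReal.ofReal_ne_top
      (ENNReal.mul_ne_top (by norm_num) hM)⟩
  have hlt := ne_top_of_le_ne_top htop key
  have hV : V ≠ ⊤ := (ENNReal.add_ne_top.1 hlt).1
  have hN : N ≠ ⊤ := by
    rintro rfl
    have h3 : ENNReal.ofReal (3 * (b / 2) ^ 2) ≠ 0 := by
      rw [Ne, ENNReal.ofReal_eq_zero, not_le]
      positivity
    exact (ENNReal.add_ne_top.1 hlt).2 (by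
      rw [ENNReal.mul_top two_ne_zero, ENNReal.mul_top h3])
  refine ⟨hV, ?_⟩
  have key' := ENNReal.toReal_mono htop key
  have gain' := ENNReal.toReal_mono (ENNReal.mul_ne_top (by norm_num) hN) hgain
  rw [ENNReal.toReal_add hV (ENNReal.add_ne_top.1 hlt).2,
    ENNReal.toReal_add hJ (ENNReal.add_ne_top.1 htop).2] at key'
  rw [ENNReal.toReal_add hM ENNReal.ofReal_ne_top] at gain'
  simp only [ENNReal.toReal_mul, ENNReal.toReal_ofNat] at key' gain'
  rw [ENNReal.toReal_ofReal (by positivity), ENNReal.toReal_ofReal (by positivity)] at key'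
  rw [ENNReal.toReal_ofReal (by positivity)] at gain'
  have hmul := mul_le_mul_of_nonneg_left gain' (show 0 ≤ 2 * (b / 2) ^ 2 by positivity)
  have e : (b / 2) ^ 2 / (s * (1 - 2 * s)) * d ^ (1 - 2 * s)
      = 2 * (b / 2) ^ 2 * (d ^ (1 - 2 * s) / (2 * s * (1 - 2 * s))) := by
    field_simp
  rw [e]
  linarith
end
end
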